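/- arXiv:2111.09769 — 3 statements merged into one kernel-verified Lean document; each statement's English description precedes it below -/
import Mathlib

section
/- Let V be a vector space over ℂ and let E₁, E₂, F₁, F₂ be linear endomorphisms of V such that E₁ ∘ E₂ = 0 and F₁ ∘ E₂ = E₂ ∘ F₁. Set Hᵢ = Eᵢ ∘ Fᵢ − Fᵢ ∘ Eᵢ for i = 1,2. Suppose v ∈ V is a nonzero vector with E₁ v = 0, E₂ v = 0, H₁ v = λ₁ v and H₂ v = λ₂ v for scalars λ₁, λ₂ ∈ ℂ. Then λ₁ λ₂ = 0. -/
/-- If `E₁∘E₂ = 0`, `F₁∘E₂ = E₂∘F₁`, `Hᵢ = EᵢFᵢ − FᵢEᵢ`, and `v ≠ 0` satisfies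
`E₁v = E₂v = 0`, `H₁v = λ₁v`, `H₂v = λ₂v`, then `λ₁λ₂ = 0`. -/
theorem stmt2 {V : Type*} [AddCommGroup V] [Module ℂ V]
    (E₁ E₂ F₁ F₂ : Module.End ℂ V)
    (h12 : E₁ * E₂ = 0) (hcomm : F₁ * E₂ = E₂ * F₁)
    (v : V) (hv : v ≠ 0) (lam₁ lam₂ : ℂ)
    (hE1 : E₁ v = 0) (hE2 : E₂ v = 0)
    (hH1 : (E₁ * F₁ - F₁ * E₁) v = lam₁ • v)
    (hH2 : (E₂ * F₂ - F₂ * E₂) v = lam₂ • v) :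
    lam₁ * lam₂ = 0 := by
  have hEF1 : E₁ (F₁ v) = lam₁ • v := by simpa [hE1] using hH1
  have hEF2 : E₂ (F₂ v) = lam₂ • v := by simpa [hE2] using hH2
  have hzero : (lam₁ * lam₂) • v = 0 :=
    calc (lam₁ * lam₂) • v = E₁ (F₁ (E₂ (F₂ v))) := by
          rw [hEF2, map_smul, map_smul, hEF1, smul_smul, mul_comm]
      _ = E₁ (E₂ (F₁ (F₂ v))) := congrArg E₁ (LinearMap.congr_fun hcomm (F₂ v))
      _ = 0 := LinearMap.congr_fun h12 (F₁ (F₂ v))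
  exact (smul_eq_zero.mp hzero).resolve_right hv
end

section
/- In ℝ⁸ with the standard inner product, let ε₁,…,ε₈ be the standard basis and ε = ε₆+ε₇+ε₈. Define the E₆ simple roots α_i = ε_i − ε_{i+1} for i = 1,…,4, α₅ = ε₄+ε₅, α₆ = ½(ε − (ε₁+ε₂+ε₃+ε₄+ε₅)), and the set of noncompact positive roots Δ⁺_nc = { α₆ + Σ_{i∈S} ε_i : S ⊆ {1,…,5}, |S| even }. Suppose Λ = Σ_{i=1}^5 Λ_i ε_i + Λ₀ ε (with Λ_i, Λ₀ ∈ ℝ) satisfies: ⟨Λ, α_j⟩ is a nonnegative integer for each j = 1,…,6, and ⟨Λ, α⟩ ∈ {0, 1} for every α ∈ Δ⁺_nc. Then Λ = 0, or Λ = (2/3) ε, or Λ = ε₁ + (1/3) ε. -/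
open RealInnerProductSpace

noncomputable section

/-- ℝ⁸ with the standard inner product. -/
abbrev E8V : Type := EuclideanSpace ℝ (Fin 8)

/-- The standard basis vectors ε₁,…,ε₈ of ℝ⁸ (0-indexed: `εv i` is ε_{i+1}). -/
def εv (i : Fin 8) : E8V := EuclideanSpace.single i 1

/-- ε = ε₆ + ε₇ + ε₈. -/
def epsE6 : E8V := εv 5 + εv 6 + εv 7

/-- Embedding of the index range {1,…,5} (0-indexed `Fin 5`) into `Fin 8`. -/
def ι5 (i : Fin 5) : Fin 8 := Fin.castLE (by norm_num) i

/-- The noncompact simple root φ = α₆ = ½(ε − (ε₁+ε₂+ε₃+ε₄+ε₅)) of E₆. -/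
def phiE6 : E8V := (1/2 : ℝ) • (epsE6 - (εv 0 + εv 1 + εv 2 + εv 3 + εv 4))

/-- The simple roots α₁,…,α₆ of E₆:
α_i = ε_i − ε_{i+1} for i = 1,…,4, α₅ = ε₄+ε₅, α₆ = φ. -/
def simpleE6 : Fin 6 → E8V :=
  ![εv 0 - εv 1, εv 1 - εv 2, εv 2 - εv 3, εv 3 - εv 4, εv 3 + εv 4, phiE6]

/-- The noncompact positive roots of E₆:
Δ⁺_nc = { φ + Σ_{i∈S} ε_i : S ⊆ {1,…,5}, |S| even }. -/
def ncRootsE6 : Set E8V :=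
  {v | ∃ S : Finset (Fin 5), Even S.card ∧ v = phiE6 + ∑ i ∈ S, εv (ι5 i)}


end

open RealInnerProductSpace

/-- The inner product with `ε_{i+1}` reads off the coordinate `i`. -/
lemma inner_εv (v : E8V) (i : Fin 8) : ⟪v, εv i⟫ = v i := by
  simp [εv, EuclideanSpace.inner_single_right]

/-- The real-number form of the classification: the dominance inequalities for `α₁, …, α₅`,
with `φ`-pairing `p` and the values at `S = ∅, {1,2}, {1,3}, {1,2,3,4}`. -/
lemma dominant_coords_classification {a b c d e p : ℝ}
    (hab : b ≤ a) (hbc : c ≤ b) (hcd : d ≤ c) (hde : e ≤ d) (hde' : -e ≤ d)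
    (hp : p = 0 ∨ p = 1)
    (h12 : p + (a + b) = 0 ∨ p + (a + b) = 1)
    (h13 : p + (a + c) = 0 ∨ p + (a + c) = 1)
    (h1234 : p + (a + b + c + d) = 0 ∨ p + (a + b + c + d) = 1) :
    b = 0 ∧ c = 0 ∧ d = 0 ∧ e = 0 ∧ ((a = 0 ∧ (p = 0 ∨ p = 1)) ∨ (a = 1 ∧ p = 0)) := by
  grind

/-- classification of dominant E₆ weights Λ with ⟨Λ,α⟩ ∈ {0,1} for all
noncompact positive roots α: Λ = 0, Λ = (2/3)ε, or Λ = ε₁ + (1/3)ε. -/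
theorem stmt6 (Λc : Fin 5 → ℝ) (Λ0 : ℝ) (Λ : E8V)
    (hΛ : Λ = ∑ i : Fin 5, Λc i • εv (ι5 i) + Λ0 • epsE6)
    (hdom : ∀ j : Fin 6, ∃ n : ℕ, ⟪Λ, simpleE6 j⟫ = (n : ℝ))
    (hmin : ∀ α ∈ ncRootsE6, ⟪Λ, α⟫ = 0 ∨ ⟪Λ, α⟫ = 1) :
    Λ = 0 ∨ Λ = (2/3 : ℝ) • epsE6 ∨ Λ = εv 0 + (1/3 : ℝ) • epsE6 := by
  have coord : Λ 0 = Λc 0 ∧ Λ 1 = Λc 1 ∧ Λ 2 = Λc 2 ∧ Λ 3 = Λc 3 ∧ Λ 4 = Λc 4 ∧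
      Λ 5 = Λ0 ∧ Λ 6 = Λ0 ∧ Λ 7 = Λ0 := by
    subst hΛ
    simp [Fin.sum_univ_five, εv, epsE6, ι5, Fin.castLE]
  obtain ⟨h0, h1, h2, h3, h4, h5, h6, h7⟩ := coord
  have nonneg (j : Fin 6) : 0 ≤ ⟪Λ, simpleE6 j⟫ := by
    obtain ⟨n, hn⟩ := hdom j
    exact hn ▸ n.cast_nonneg
  have d0 := nonneg 0
  have d1 := nonneg 1
  have d2 := nonneg 2
  have d3 := nonneg 3
  have d4 := nonneg 4
  simp only [simpleE6, Matrix.cons_val, inner_sub_right, inner_add_right, inner_εv]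
    at d0 d1 d2 d3 d4
  have root (S : Finset (Fin 5)) (hS : Even S.card) :
      ⟪Λ, phiE6⟫ + ∑ i ∈ S, Λ (ι5 i) = 0 ∨ ⟪Λ, phiE6⟫ + ∑ i ∈ S, Λ (ι5 i) = 1 := by
    simpa only [inner_add_right, inner_sum, inner_εv] using hmin _ ⟨S, hS, rfl⟩
  have phi : ⟪Λ, phiE6⟫ = (3 * Λ0 - (Λ 0 + Λ 1 + Λ 2 + Λ 3 + Λ 4)) / 2 := by
    simp only [phiE6, epsE6, inner_smul_right, inner_sub_right, inner_add_right, inner_εv,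
      h5, h6, h7]
    ring
  have r := root ∅ (by decide)
  have r12 := root {0, 1} (by decide)
  have r13 := root {0, 2} (by decide)
  have r1234 := root {0, 1, 2, 3} (by decide)
  simp [ι5, Fin.castLE, ← add_assoc] at r r12 r13 r1234
  obtain ⟨hb, hc, hd, he, h⟩ := dominant_coords_classification (a := Λ 0) (b := Λ 1) (c := Λ 2)
    (d := Λ 3) (e := Λ 4) (p := ⟪Λ, phiE6⟫) (by linarith) (by linarith) (by linarith)
    (by linarith) (by linarith) r (by rwa [← add_assoc])
    (by rwa [← add_assoc]) (by simpa only [← add_assoc] using r1234)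
  rw [phi, hb, hc, hd, he] at h
  have hΛ' : Λ = Λ 0 • εv 0 + Λ0 • epsE6 := by
    rw [Fin.sum_univ_five, ← h0, ← h1, ← h2, ← h3, ← h4, hb, hc, hd, he] at hΛ
    simp only [zero_smul, add_zero] at hΛ
    exact hΛ
  rcases h with ⟨ha, hp | hp⟩ | ⟨ha, hp⟩
  · left
    rw [hΛ', ha, show Λ0 = 0 by linarith, zero_smul, zero_smul, add_zero]
  · right; left
    rw [hΛ', ha, show Λ0 = 2 / 3 by linarith, zero_smul, zero_add]
  · right; right
    rw [hΛ', ha, show Λ0 = 1 / 3 by linarith, one_smul]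
end

section
/- In ℝ⁸ with the standard inner product, let ε₁,…,ε₈ be the standard basis and ε = ε₆+ε₇+ε₈. Let Δ⁺ = { ε_i − ε_j, ε_i + ε_j : 1 ≤ i < j ≤ 5 } ∪ { ½(ε + Σ_{i=1}^5 s_i ε_i) : s_i ∈ {±1}, Π_{i=1}^5 s_i = −1 }, Δ = Δ⁺ ∪ (−Δ⁺), φ = ½(ε − (ε₁+ε₂+ε₃+ε₄+ε₅)), ψ = ½(ε + ε₁+ε₂+ε₃+ε₄−ε₅), and Δ⁺_nc = { φ + Σ_{i∈S} ε_i : S ⊆ {1,…,5}, |S| even }. Then φ, ψ ∈ Δ⁺_nc, ⟨φ, ψ⟩ = 0, ψ − φ ∉ Δ, and for every α ∈ Δ⁺_nc with α ∉ {φ, ψ}, either α − φ ∈ Δ or α − ψ ∈ Δ. -/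
open RealInnerProductSpace

noncomputable section

/-- The positive roots of E₆:
Δ⁺ = { ε_i − ε_j, ε_i + ε_j : 1 ≤ i < j ≤ 5 } ∪ { ½(ε + Σ s_i ε_i) : s_i = ±1, Π s_i = −1 }. -/
def posRootsE6 : Set E8V :=
  {v | (∃ i j : Fin 5, i < j ∧ (v = εv (ι5 i) - εv (ι5 j) ∨ v = εv (ι5 i) + εv (ι5 j))) ∨
       (∃ s : Fin 5 → ℝ, (∀ i, s i = 1 ∨ s i = -1) ∧ (∏ i, s i) = -1 ∧
         v = (1/2 : ℝ) • (epsE6 + ∑ i : Fin 5, s i • εv (ι5 i)))}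

/-- The root system of E₆: Δ = Δ⁺ ∪ (−Δ⁺). -/
def rootsE6 : Set E8V := posRootsE6 ∪ {v | -v ∈ posRootsE6}

/-- ψ = ½(ε + ε₁ + ε₂ + ε₃ + ε₄ − ε₅). -/
def psiE6 : E8V := (1/2 : ℝ) • (epsE6 + εv 0 + εv 1 + εv 2 + εv 3 - εv 4)

end

open RealInnerProductSpace

lemma inner_εv_s13 (i j : Fin 8) : ⟪εv i, εv j⟫ = if i = j then (1 : ℝ) else 0 := by
  simp [εv, EuclideanSpace.inner_single_left]

lemma psiE6_eq : psiE6 = phiE6 + (εv 0 + εv 1 + εv 2 + εv 3) := by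
  unfold psiE6 phiE6
  module

/-- Every positive root of E₆ has squared length 2. -/
lemma inner_self_of_mem_posRootsE6 {v : E8V} (hv : v ∈ posRootsE6) : ⟪v, v⟫ = (2 : ℝ) := by
  rcases hv with ⟨i, j, hij, h⟩ | ⟨s, hs, -, rfl⟩
  · have hne : ι5 i ≠ ι5 j := fun h => hij.ne (Fin.castLE_injective _ h)
    rcases h with rfl | rfl <;>
      simp only [inner_add_left, inner_add_right, inner_sub_left, inner_sub_right, inner_εv_s13,
        hne, hne.symm, if_true, if_false] <;> norm_num
  · have hsq : ∀ i, s i * s i = 1 := fun i => by rcases hs i with h | h <;> simp [h]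
    simp only [epsE6, ι5, Fin.sum_univ_five, inner_add_left, inner_add_right,
      real_inner_smul_left, real_inner_smul_right, inner_εv_s13]
    simp [Fin.ext_iff]
    linarith [hsq 0, hsq 1, hsq 2, hsq 3, hsq 4]

/-- Every root of E₆ has squared length 2. -/
lemma inner_self_of_mem_rootsE6 {v : E8V} (hv : v ∈ rootsE6) : ⟪v, v⟫ = (2 : ℝ) := by
  rcases hv with h | h
  · exact inner_self_of_mem_posRootsE6 h
  · simpa only [inner_neg_neg] using inner_self_of_mem_posRootsE6 h

lemma εv_add_mem_rootsE6 {i j : Fin 5} (hij : i ≠ j) : εv (ι5 i) + εv (ι5 j) ∈ rootsE6 := by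
  rcases hij.lt_or_gt with h | h
  · exact Or.inl (Or.inl ⟨i, j, h, Or.inr rfl⟩)
  · exact Or.inl (Or.inl ⟨j, i, h, Or.inr (add_comm _ _)⟩)

lemma εv_sub_mem_rootsE6 {i j : Fin 5} (hij : i ≠ j) : εv (ι5 i) - εv (ι5 j) ∈ rootsE6 := by
  rcases hij.lt_or_gt with h | h
  · exact Or.inl (Or.inl ⟨i, j, h, Or.inl rfl⟩)
  · exact Or.inr (Or.inl ⟨j, i, h, Or.inl (neg_sub _ _)⟩)

lemma psiE6_eq_sum : psiE6 = phiE6 + (∑ i, εv (ι5 i) - εv (ι5 4)) := by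
  rw [psiE6_eq, Fin.sum_univ_five, add_sub_cancel_right]
  rfl

lemma psiE6_mem_ncRootsE6 : psiE6 ∈ ncRootsE6 :=
  ⟨{4}ᶜ, by decide, by
    rw [psiE6_eq_sum, ← Finset.sum_compl_add_sum {4}, Finset.sum_singleton,
      add_sub_cancel_right]⟩

lemma inner_phiE6_psiE6 : ⟪phiE6, psiE6⟫ = (0 : ℝ) := by
  simp only [phiE6, psiE6, epsE6, inner_add_left, inner_add_right, inner_sub_left,
    inner_sub_right, real_inner_smul_left, real_inner_smul_right, inner_εv_s13]
  simp [Fin.ext_iff]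

lemma psiE6_sub_phiE6_notMem_rootsE6 : psiE6 - phiE6 ∉ rootsE6 := by
  intro h
  have h2 := inner_self_of_mem_rootsE6 h
  rw [psiE6_eq, add_sub_cancel_left] at h2
  simp only [inner_add_left, inner_add_right, inner_εv_s13] at h2
  simp [Fin.ext_iff] at h2
  norm_num at h2

/-- P_φ = {φ, ψ} is a maximal set of noncompact positive roots of E₆ whose
pairwise differences are not roots: φ, ψ ∈ Δ⁺_nc, ⟨φ,ψ⟩ = 0, ψ − φ ∉ Δ, and every other
α ∈ Δ⁺_nc satisfies α − φ ∈ Δ or α − ψ ∈ Δ. -/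
theorem stmt13 :
    phiE6 ∈ ncRootsE6 ∧ psiE6 ∈ ncRootsE6 ∧ ⟪phiE6, psiE6⟫ = 0 ∧
    psiE6 - phiE6 ∉ rootsE6 ∧
    ∀ α ∈ ncRootsE6, α ≠ phiE6 → α ≠ psiE6 →
      (α - phiE6 ∈ rootsE6 ∨ α - psiE6 ∈ rootsE6) := by
  refine ⟨⟨∅, by simp, by simp⟩, psiE6_mem_ncRootsE6, inner_phiE6_psiE6,
    psiE6_sub_phiE6_notMem_rootsE6, ?_⟩
  rintro _ ⟨S, hS, rfl⟩ hφ hψ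
  have hle : S.card ≤ 5 := by simpa using S.card_le_univ
  have hcard : S.card = 0 ∨ S.card = 2 ∨ S.card = 4 := by
    obtain ⟨k, hk⟩ := hS
    omega
  rcases hcard with h0 | h2 | h4
  · simp [Finset.card_eq_zero.mp h0] at hφ
  · obtain ⟨i, j, hij, rfl⟩ := Finset.card_eq_two.mp h2
    left
    rw [add_sub_cancel_left, Finset.sum_pair hij]
    exact εv_add_mem_rootsE6 hij
  · obtain ⟨k, hk⟩ : ∃ k, Sᶜ = {k} := Finset.card_eq_one.mp (by
      rw [Finset.card_compl, h4, Fintype.card_fin])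
    have hsum : ∑ i ∈ S, εv (ι5 i) = ∑ i, εv (ι5 i) - εv (ι5 k) := by
      rw [← Finset.sum_add_sum_compl S, hk, Finset.sum_singleton, add_sub_cancel_right]
    rw [hsum] at hψ ⊢
    have hk4 : (4 : Fin 5) ≠ k := by
      rintro rfl
      exact hψ psiE6_eq_sum.symm
    right
    rw [psiE6_eq_sum, add_sub_add_left_eq_sub, sub_sub_sub_cancel_left]
    exact εv_sub_mem_rootsE6 hk4
end
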